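/- Fix a prime power q and integer k ≥ 2, and let φ = z - 1. The limit as n → ∞ of the probability that a uniformly random α ∈ GL(n,q) has all parts of the partition λ_{z-1}(α) strictly less than k equals Π over r ≥ 1 with r ≡ 0 or ±k (mod 2k+1) of (1 - q^(-r)). -/

import Mathlib

open Filter Matrix

/-- The finite `q`-Pochhammer product `(x; x)_n = ∏_{i=1}^n (1 - x^i)`. -/
noncomputable def qPoch (x : ℝ) (n : ℕ) : ℝ := ∏ i ∈ Finset.range n, (1 - x ^ (i + 1))

lemma qPoch_zero (x : ℝ) : qPoch x 0 = 1 := by simp [qPoch]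

lemma qPoch_succ (x : ℝ) (n : ℕ) : qPoch x (n + 1) = qPoch x n * (1 - x ^ (n + 1)) :=
  Finset.prod_range_succ _ _

lemma qPoch_pos {x : ℝ} (h0 : 0 < x) (h1 : x < 1) (n : ℕ) : 0 < qPoch x n :=
  Finset.prod_pos fun i _ => sub_pos.2 (pow_lt_one₀ h0.le h1 (by simp))

lemma multipliable_one_sub {f : ℕ → ℝ} (hf : Summable f) : Multipliable fun i => 1 - f i := by
  simpa [sub_eq_add_neg] using multipliable_one_add_of_summable (f := fun i => - f i) (by
    simpa using hf.abs)

lemma summable_pow_succ {x : ℝ} (h0 : 0 < x) (h1 : x < 1) : Summable fun i : ℕ => x ^ (i + 1) :=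
  (summable_nat_add_iff 1).2 (summable_geometric_of_lt_one h0.le h1)

lemma tendsto_qPoch {x : ℝ} (h0 : 0 < x) (h1 : x < 1) :
    Tendsto (qPoch x) atTop (nhds (∏' i : ℕ, (1 - x ^ (i + 1)))) :=
  (multipliable_one_sub (summable_pow_succ h0 h1)).hasProd.tendsto_prod_nat

lemma antitone_qPoch {x : ℝ} (h0 : 0 < x) (h1 : x < 1) : Antitone (qPoch x) :=
  antitone_nat_of_succ_le fun n => by
    rw [qPoch_succ]
    exact mul_le_of_le_one_right (qPoch_pos h0 h1 n).le (by linarith [pow_pos h0 (n + 1)])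

lemma tprod_qPoch_pos {x : ℝ} (h0 : 0 < x) (h1 : x < 1) : 0 < ∏' i : ℕ, (1 - x ^ (i + 1)) := by
  refine lt_of_le_of_ne (ge_of_tendsto' (tendsto_qPoch h0 h1) fun n => (qPoch_pos h0 h1 n).le) ?_
  have := tprod_one_add_ne_zero_of_summable (f := fun i : ℕ => - x ^ (i + 1))
    (fun i => by
      have := pow_lt_one₀ h0.le h1 (Nat.succ_ne_zero i)
      rw [← sub_eq_add_neg]
      exact (sub_pos.2 this).ne') (by
      simpa [abs_of_pos h0] using summable_pow_succ h0 h1)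
  simpa [sub_eq_add_neg] using this.symm

lemma inv_qPoch_le {x : ℝ} (h0 : 0 < x) (h1 : x < 1) (n : ℕ) :
    (qPoch x n)⁻¹ ≤ (∏' i : ℕ, (1 - x ^ (i + 1)))⁻¹ :=
  inv_anti₀ (tprod_qPoch_pos h0 h1) ((antitone_qPoch h0 h1).le_of_tendsto (tendsto_qPoch h0 h1) n)

lemma tendsto_inv_qPoch {x : ℝ} (h0 : 0 < x) (h1 : x < 1) {u : ℕ → ℕ} (hu : Tendsto u atTop atTop) :
    Tendsto (fun n => (qPoch x (u n))⁻¹) atTop (nhds (∏' i : ℕ, (1 - x ^ (i + 1)))⁻¹) :=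
  ((tendsto_qPoch h0 h1).inv₀ (tprod_qPoch_pos h0 h1).ne').comp hu

lemma abs_inv_qPoch_le {x : ℝ} (h0 : 0 < x) (h1 : x < 1) (n : ℕ) :
    |(qPoch x n)⁻¹| ≤ (∏' i : ℕ, (1 - x ^ (i + 1)))⁻¹ := by
  rw [abs_of_pos (inv_pos.2 (qPoch_pos h0 h1 n))]
  exact inv_qPoch_le h0 h1 n

/-- The `q`-binomial theorem, divided by `(y; y)_N`. -/
theorem sum_antidiagonal_qPoch {y : ℝ} (hy : ∀ n, qPoch y n ≠ 0) (a b : ℝ) (N : ℕ) :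
    ∑ p ∈ Finset.HasAntidiagonal.antidiagonal N,
      ((-b) ^ p.1 * y ^ (p.1.choose 2) / qPoch y p.1) * (a ^ p.2 / qPoch y p.2) =
      (∏ i ∈ Finset.range N, (a - b * y ^ i)) / qPoch y N := by
  have hy1 (n : ℕ) : 1 - y ^ (n + 1) ≠ 0 := fun h => hy (n + 1) (by rw [qPoch_succ, h, mul_zero])
  set u : ℕ → ℝ := fun s => (-b) ^ s * y ^ (s.choose 2) / qPoch y s with hu
  set v : ℕ → ℝ := fun t => a ^ t / qPoch y t with hv
  have hu' (s : ℕ) : u (s + 1) * (1 - y ^ (s + 1)) = -b * y ^ s * u s := by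
    simp only [hu, qPoch_succ, Nat.choose_succ_succ' s 1, Nat.choose_one_right]
    have := hy s
    have := hy1 s
    field_simp
    ring
  have hv' (t : ℕ) : v (t + 1) * (1 - y ^ (t + 1)) = a * v t := by
    simp only [hv, qPoch_succ]
    have := hy t
    have := hy1 t
    field_simp
    ring
  change ∑ p ∈ Finset.HasAntidiagonal.antidiagonal N, u p.1 * v p.2 = _
  induction N with
  | zero => simp [hu, hv, qPoch_zero]
  | succ N ih =>
    have key : (∑ p ∈ Finset.HasAntidiagonal.antidiagonal (N + 1), u p.1 * v p.2) *
        (1 - y ^ (N + 1)) =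
        (a - b * y ^ N) * ∑ p ∈ Finset.HasAntidiagonal.antidiagonal N, u p.1 * v p.2 := by
      have e : (∑ p ∈ Finset.HasAntidiagonal.antidiagonal (N + 1), u p.1 * v p.2) *
        (1 - y ^ (N + 1)) =
          ∑ p ∈ Finset.HasAntidiagonal.antidiagonal (N + 1), u p.1 * (v p.2 * (1 - y ^ p.2)) +
          ∑ p ∈ Finset.HasAntidiagonal.antidiagonal (N + 1),
            (u p.1 * (1 - y ^ p.1)) * (y ^ p.2 * v p.2) := by
        rw [Finset.sum_mul, ← Finset.sum_add_distrib]
        refine Finset.sum_congr rfl fun p hp => ?_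
        rw [← Finset.HasAntidiagonal.mem_antidiagonal.1 hp, pow_add]
        ring
      rw [e, Finset.Nat.sum_antidiagonal_succ', Finset.Nat.sum_antidiagonal_succ]
      simp only [hu', hv', pow_zero, sub_self, mul_zero, zero_mul, zero_add]
      rw [← Finset.sum_add_distrib, Finset.mul_sum]
      refine Finset.sum_congr rfl fun p hp => ?_
      rw [← Finset.HasAntidiagonal.mem_antidiagonal.1 hp, pow_add]
      ring
    rw [Finset.prod_range_succ, qPoch_succ, eq_div_iff (mul_ne_zero (hy _) (hy1 _)),
      mul_comm (qPoch y N), ← mul_assoc, key, ih]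
    have := hy N
    field_simp

lemma sum_range_fold (f : ℕ → ℝ) (m : ℕ) :
    ∑ s ∈ Finset.range (2 * m + 1), f s =
      ∑ j ∈ Finset.range (m + 1), if j = 0 then f m else f (m + j) + f (m - j) := by
  rw [show 2 * m + 1 = m + (m + 1) by ring, Finset.sum_range_add, Finset.sum_range_succ',
    Finset.sum_range_succ' (fun j => if j = 0 then f m else f (m + j) + f (m - j)),
    ← Finset.sum_range_reflect]
  simp only [Nat.add_eq_zero_iff, one_ne_zero, and_false, if_false, if_true, add_zero,
    Finset.sum_add_distrib]
  rw [← add_assoc, add_comm (∑ j ∈ Finset.range m, f (m - 1 - j))]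
  congr 2
  exact Finset.sum_congr rfl fun j _ => by congr 1; omega

/-- The `j`-th term of the theta series in Jacobi's triple product, folded over `j ↔ -j`. -/
noncomputable def jacobiTerm (z w : ℝ) (j : ℕ) : ℝ :=
  if j = 0 then 1 else (-1) ^ j * (z * w) ^ (j.choose 2) * (z ^ j + w ^ j)

lemma choose_two_add (a b : ℕ) : (a + b).choose 2 = a.choose 2 + b.choose 2 + a * b := by
  induction b with
  | zero => simp
  | succ b ih =>
    rw [← add_assoc, Nat.choose_succ_succ' _ 1, ih, Nat.choose_succ_succ' b 1]
    simp only [Nat.choose_one_right]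
    ring

lemma choose_two_mul_two_add (j : ℕ) : j.choose 2 * 2 + j = j * j := by
  induction j with
  | zero => simp
  | succ j ih =>
    rw [Nat.choose_succ_succ' j 1, Nat.choose_one_right]
    linarith

/-- A finite form of Jacobi's triple product identity. -/
theorem sum_jacobiTerm_div {z w : ℝ} (hz : z ≠ 0) (hw : w ≠ 0) (hy : ∀ n, qPoch (z * w) n ≠ 0)
    (m : ℕ) :
    ∑ j ∈ Finset.range (m + 1),
      jacobiTerm z w j / (qPoch (z * w) (m - j) * qPoch (z * w) (m + j)) =
      (∏ i ∈ Finset.range m, ((1 - z * (z * w) ^ i) * (1 - w * (z * w) ^ i))) /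
        qPoch (z * w) (2 * m) := by
  have h := sum_antidiagonal_qPoch hy ((z * w) ^ m) z (2 * m)
  set y := z * w with hyd
  have hy0 : y ≠ 0 := mul_ne_zero hz hw
  have hK : (-z) ^ m * y ^ (m.choose 2 + m * m) ≠ 0 :=
    mul_ne_zero (pow_ne_zero _ (neg_ne_zero.2 hz)) (pow_ne_zero _ hy0)
  rw [Finset.Nat.sum_antidiagonal_eq_sum_range_succ_mk] at h
  have hprod : ∏ i ∈ Finset.range (2 * m), (y ^ m - z * y ^ i) =
      ((-z) ^ m * y ^ (m.choose 2 + m * m)) *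
        ∏ i ∈ Finset.range m, ((1 - z * y ^ i) * (1 - w * y ^ i)) := by
    have e1 : ∏ i ∈ Finset.range m, (y ^ m - z * y ^ i) =
        ((-z) ^ m * y ^ (m.choose 2)) * ∏ i ∈ Finset.range m, (1 - w * y ^ i) := by
      rw [← Finset.prod_range_reflect (fun i => 1 - w * y ^ i), Nat.choose_two_right,
        ← Finset.sum_range_id, ← Finset.prod_pow_eq_pow_sum]
      nth_rewrite 3 [← Finset.card_range m]
      rw [← Finset.prod_const, ← Finset.prod_mul_distrib, ← Finset.prod_mul_distrib]
      refine Finset.prod_congr rfl fun i hi => ?_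
      have : m = i + (m - 1 - i) + 1 := by have := Finset.mem_range.1 hi; omega
      conv_lhs => rw [this]
      rw [pow_succ, pow_add, hyd]
      ring
    rw [two_mul, Finset.prod_range_add, e1, Finset.prod_mul_distrib]
    have e2 : ∏ i ∈ Finset.range m, (y ^ m - z * y ^ (m + i)) =
        y ^ (m * m) * ∏ i ∈ Finset.range m, (1 - z * y ^ i) := by
      rw [Finset.prod_congr rfl fun i _ => show y ^ m - z * y ^ (m + i) = y ^ m * (1 - z * y ^ i) by
        rw [pow_add]; ring, Finset.prod_mul_distrib, Finset.prod_const, Finset.card_range, pow_mul]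
    rw [e2, pow_add]
    ring
  rw [hprod, Nat.succ_eq_add_one, sum_range_fold,
    mul_div_assoc ((-z) ^ m * _)] at h
  refine mul_left_cancel₀ hK (Eq.trans ?_ h)
  rw [Finset.mul_sum]
  refine Finset.sum_congr rfl fun j hj => ?_
  obtain ⟨l, rfl⟩ := Nat.exists_eq_add_of_le (Nat.lt_succ_iff.1 (Finset.mem_range.1 hj))
  have n1 := hy l
  have n2 := hy (j + l + j)
  unfold jacobiTerm
  split_ifs with h0
  · subst h0
    have n3 : 2 * l - l = l := by omega
    simp only [zero_add, add_zero, Nat.sub_zero, n3]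
    simp only [zero_add, add_zero] at n2
    rw [pow_add, ← pow_mul]
    field_simp
  · have n3 : 2 * (j + l) - (j + l + j) = l := by omega
    have n4 : 2 * (j + l) - l = j + l + j := by omega
    have n5 : j + l - j = l := by omega
    simp only [n3, n4, n5]
    have c1 : (-z) ^ (j + l + j) * y ^ ((j + l + j).choose 2) * (y ^ (j + l)) ^ l =
        ((-z) ^ (j + l) * y ^ ((j + l).choose 2 + (j + l) * (j + l))) *
          ((-1) ^ j * y ^ (j.choose 2) * z ^ j) := by
      rw [choose_two_add (j + l) j]
      rw [show (j + l) * (j + l) = (j + l) * j + (j + l) * l by ring, neg_pow z (j + l + j),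
        neg_pow z (j + l)]
      simp only [pow_add]
      ring
    have c2 : (-z) ^ l * y ^ (l.choose 2) * (y ^ (j + l)) ^ (j + l + j) =
        ((-z) ^ (j + l) * y ^ ((j + l).choose 2 + (j + l) * (j + l))) *
          ((-1) ^ j * y ^ (j.choose 2) * w ^ j) := by
      have c3 := choose_two_mul_two_add j
      have c4 : (-z) ^ j * ((-1) ^ j * w ^ j) = y ^ j := by
        rw [← mul_pow, ← mul_pow, hyd]; ring
      rw [choose_two_add j l]
      have : ((-z) ^ (j + l) * y ^ (j.choose 2 + l.choose 2 + j * l + (j + l) * (j + l))) *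
          ((-1) ^ j * y ^ (j.choose 2) * w ^ j) = (-z) ^ l * y ^ (j.choose 2 + l.choose 2 +
            j * l + (j + l) * (j + l) + j.choose 2) * ((-z) ^ j * ((-1) ^ j * w ^ j)) := by
        rw [pow_add (-z), pow_add y _ (j.choose 2)]; ring
      rw [this, c4, mul_assoc, mul_assoc, ← pow_mul, ← pow_add, ← pow_add]
      congr 2
      nlinarith
    rw [div_mul_div_comm, div_mul_div_comm, c1, c2]
    field_simp
    ring

/-- A finite form of Euler's identity. -/
theorem sum_euler_div {x : ℝ} (h0 : 0 < x) (h1 : x < 1) (n : ℕ) :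
    ∑ j ∈ Finset.range (n + 1),
      (-1) ^ j * x ^ ((j + 1).choose 2) / qPoch x j * (qPoch x (n - j))⁻¹ = 1 := by
  have hP (n : ℕ) : qPoch x n ≠ 0 := (qPoch_pos h0 h1 n).ne'
  have h := sum_antidiagonal_qPoch hP 1 x n
  rw [Finset.Nat.sum_antidiagonal_eq_sum_range_succ_mk,
    Finset.prod_congr rfl fun i _ => by rw [← pow_succ' x i]] at h
  change _ = qPoch x n / qPoch x n at h
  rw [div_self (hP n)] at h
  refine Eq.trans ?_ h
  refine Finset.sum_congr rfl fun j _ => ?_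
  rw [Nat.choose_succ_succ' j 1, Nat.choose_one_right, neg_pow, pow_add]
  ring

theorem tendsto_sum_range_mul {a : ℕ → ℝ} (ha : Summable a) {b : ℕ → ℕ → ℝ} {l C : ℝ}
    (hb : ∀ j, Tendsto (fun m => b m j) atTop (nhds l)) (hC : ∀ m j, |b m j| ≤ C) :
    Tendsto (fun m => ∑ j ∈ Finset.range (m + 1), a j * b m j) atTop (nhds ((∑' j, a j) * l)) := by
  have hC0 : 0 ≤ C := (abs_nonneg _).trans (hC 0 0)
  have h := tendsto_tsum_of_dominated_convergence (𝓕 := atTop)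
    (f := fun m j => if j < m + 1 then a j * b m j else 0) (g := fun j => a j * l)
    (bound := fun j => |a j| * C) (ha.abs.mul_right C) (fun j => by
      refine ((hb j).const_mul (a j)).congr' ?_
      filter_upwards [eventually_ge_atTop j] with m hm
      rw [if_pos (by omega)]) (.of_forall fun m j => by
        split_ifs
        · rw [Real.norm_eq_abs, abs_mul]
          exact mul_le_mul_of_nonneg_left (hC m j) (abs_nonneg _)
        · simpa using mul_nonneg (abs_nonneg (a j)) hC0)
  rw [tsum_mul_right] at h
  refine h.congr fun m => ?_
  rw [tsum_eq_sum (s := Finset.range (m + 1)) fun j hj => if_neg (by simpa using hj)]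
  exact Finset.sum_congr rfl fun j hj => if_pos (Finset.mem_range.1 hj)

theorem tendsto_sum_div_qPoch {x : ℝ} (h0 : 0 < x) (h1 : x < 1) {a : ℕ → ℝ} (ha : Summable a) :
    Tendsto (fun m => ∑ j ∈ Finset.range (m + 1), a j * (qPoch x (m - j))⁻¹) atTop
      (nhds ((∑' j, a j) * (∏' i : ℕ, (1 - x ^ (i + 1)))⁻¹)) :=
  tendsto_sum_range_mul ha (fun j => tendsto_inv_qPoch h0 h1 (tendsto_sub_atTop_nat j))
    fun _ _ => abs_inv_qPoch_le h0 h1 _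

theorem tendsto_sum_div_qPoch_mul {x : ℝ} (h0 : 0 < x) (h1 : x < 1) {a : ℕ → ℝ} (ha : Summable a) :
    Tendsto (fun m => ∑ j ∈ Finset.range (m + 1), a j / (qPoch x (m - j) * qPoch x (m + j))) atTop
      (nhds ((∑' j, a j) *
        ((∏' i : ℕ, (1 - x ^ (i + 1)))⁻¹ * (∏' i : ℕ, (1 - x ^ (i + 1)))⁻¹))) := by
  simp only [div_eq_mul_inv, mul_inv]
  refine tendsto_sum_range_mul ha (fun j => (tendsto_inv_qPoch h0 h1 (tendsto_sub_atTop_nat j)).mul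
    (tendsto_inv_qPoch h0 h1 (tendsto_add_atTop_nat j)))
    (C := (∏' i : ℕ, (1 - x ^ (i + 1)))⁻¹ * (∏' i : ℕ, (1 - x ^ (i + 1)))⁻¹) fun m j => ?_
  rw [abs_mul]
  exact mul_le_mul (abs_inv_qPoch_le h0 h1 _) (abs_inv_qPoch_le h0 h1 _) (abs_nonneg _)
    (inv_pos.2 (tprod_qPoch_pos h0 h1)).le

lemma summable_pow_choose_two {x : ℝ} (h0 : 0 < x) (h1 : x < 1) :
    Summable fun j : ℕ => x ^ ((j + 1).choose 2) :=
  (summable_geometric_of_lt_one h0.le h1).of_nonneg_of_le (fun _ => by positivity) fun j =>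
    pow_le_pow_of_le_one h0.le h1.le (by
      rw [Nat.choose_succ_succ' j 1, Nat.choose_one_right]; omega)

/-- Euler's identity `∑ (-1)^j x^(j(j+1)/2) / (x; x)_j = (x; x)_∞`. -/
theorem hasSum_euler {x : ℝ} (h0 : 0 < x) (h1 : x < 1) :
    HasSum (fun j : ℕ => (-1) ^ j * x ^ ((j + 1).choose 2) / qPoch x j)
      (∏' i : ℕ, (1 - x ^ (i + 1))) := by
  have hs : Summable fun j : ℕ => (-1) ^ j * x ^ ((j + 1).choose 2) / qPoch x j := by
    refine .of_norm_bounded ((summable_pow_choose_two h0 h1).mul_right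
      (∏' i : ℕ, (1 - x ^ (i + 1)))⁻¹) fun j => ?_
    rw [div_eq_mul_inv, norm_mul, norm_mul, norm_pow, norm_neg, norm_one, one_pow, one_mul,
      Real.norm_of_nonneg (by positivity)]
    exact mul_le_mul_of_nonneg_left (abs_inv_qPoch_le h0 h1 _) (by positivity)
  have h := tendsto_sum_div_qPoch h0 h1 hs
  simp only [sum_euler_div h0 h1] at h
  have := tendsto_nhds_unique h tendsto_const_nhds
  rw [mul_inv_eq_one₀ (tprod_qPoch_pos h0 h1).ne'] at this
  rw [← this]
  exact hs.hasSum

lemma summable_jacobiTerm {z w : ℝ} (hz : 0 < z) (hw : 0 < w) (hz1 : z ≤ 1) (hw1 : w ≤ 1)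
    (hzw : z * w < 1) : Summable (jacobiTerm z w) := by
  have hy := mul_pos hz hw
  rw [← summable_nat_add_iff 1]
  refine .of_norm_bounded ((summable_pow_choose_two hy hzw).mul_right 2) fun j => ?_
  rw [jacobiTerm, if_neg (by simp), norm_mul, norm_mul, norm_pow, norm_neg, norm_one, one_pow,
    one_mul, Real.norm_of_nonneg (by positivity), Real.norm_of_nonneg (by positivity)]
  gcongr
  linarith [pow_le_one₀ (n := j + 1) hz.le hz1, pow_le_one₀ (n := j + 1) hw.le hw1]

/-- Jacobi's triple product identity. -/
theorem tendsto_jacobi {z w : ℝ} (hz : 0 < z) (hw : 0 < w) (hz1 : z ≤ 1) (hw1 : w ≤ 1)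
    (hzw : z * w < 1) :
    Tendsto (fun m => ∏ i ∈ Finset.range m,
      ((1 - z * (z * w) ^ i) * (1 - w * (z * w) ^ i) * (1 - (z * w) ^ (i + 1)))) atTop
      (nhds (∑' j, jacobiTerm z w j)) := by
  have hy := mul_pos hz hw
  have h := tendsto_sum_div_qPoch_mul hy hzw (summable_jacobiTerm hz hw hz1 hw1 hzw)
  have hP (n : ℕ) := (qPoch_pos hy hzw n).ne'
  simp only [sum_jacobiTerm_div hz.ne' hw.ne' hP] at h
  have h2 : Tendsto (fun n => qPoch (z * w) (2 * n)) atTop _ :=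
    (tendsto_qPoch hy hzw).comp (tendsto_id.const_mul_atTop' two_pos)
  have h3 := (h.mul h2).mul (tendsto_qPoch hy hzw)
  have hne := (tprod_qPoch_pos hy hzw).ne'
  have e (a p : ℝ) (hp : p ≠ 0) : a * (p⁻¹ * p⁻¹) * p * p = a := by field_simp
  rw [e _ _ hne] at h3
  refine h3.congr fun m => ?_
  rw [div_mul_cancel₀ _ (hP _), qPoch, ← Finset.prod_mul_distrib]

/-- The `β`-sequence of the Bailey pair obtained from the unit Bailey pair after `k` steps. -/
noncomputable def baileyBeta (x : ℝ) (k r : ℕ) : ℝ :=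
  ∑ j ∈ Finset.range (r + 1),
    (jacobiTerm 1 x j * x ^ (k * (j * j))) / (qPoch x (r - j) * qPoch x (r + j))

lemma baileyBeta_zero {x : ℝ} (h0 : 0 < x) (h1 : x < 1) (r : ℕ) :
    baileyBeta x 0 r = if r = 0 then 1 else 0 := by
  have := sum_jacobiTerm_div one_ne_zero h0.ne' (fun n => by
    rw [one_mul]; exact (qPoch_pos h0 h1 n).ne') r
  simp only [one_mul] at this
  simp only [baileyBeta, zero_mul, pow_zero, mul_one, this]
  split_ifs with h
  · simp [h, qPoch_zero]
  · obtain ⟨r, rfl⟩ := Nat.exists_eq_succ_of_ne_zero h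
    simp [Finset.prod_range_succ']

/-- A form of the `q`-Vandermonde identity. -/
theorem sum_qVandermonde {x : ℝ} (h0 : 0 < x) (h1 : x < 1) (M a : ℕ) :
    ∑ p ∈ Finset.HasAntidiagonal.antidiagonal M,
      x ^ (p.1 * (p.1 + a)) / (qPoch x p.1 * qPoch x p.2 * qPoch x (p.1 + a)) =
      (qPoch x M * qPoch x (M + a))⁻¹ := by
  induction M generalizing a with
  | zero => simp [qPoch_zero]
  | succ M ih =>
    have hP (n : ℕ) := (qPoch_pos h0 h1 n).ne'
    have hP1 (n : ℕ) : 1 - x ^ (n + 1) ≠ 0 :=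
      (sub_pos.2 (pow_lt_one₀ h0.le h1 (Nat.succ_ne_zero n))).ne'
    set f : ℕ × ℕ → ℝ := fun p =>
      x ^ (p.1 * (p.1 + a)) / (qPoch x p.1 * qPoch x p.2 * qPoch x (p.1 + a)) with hf
    have key : (∑ p ∈ Finset.HasAntidiagonal.antidiagonal (M + 1), f p) * (1 - x ^ (M + 1)) =
        (qPoch x M * qPoch x (M + (a + 1)))⁻¹ := by
      have e : (∑ p ∈ Finset.HasAntidiagonal.antidiagonal (M + 1), f p) * (1 - x ^ (M + 1)) =
          ∑ p ∈ Finset.HasAntidiagonal.antidiagonal (M + 1), x ^ p.1 * (f p * (1 - x ^ p.2)) +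
          ∑ p ∈ Finset.HasAntidiagonal.antidiagonal (M + 1), f p * (1 - x ^ p.1) := by
        rw [Finset.sum_mul, ← Finset.sum_add_distrib]
        refine Finset.sum_congr rfl fun p hp => ?_
        rw [← Finset.HasAntidiagonal.mem_antidiagonal.1 hp, pow_add]
        ring
      rw [e, Finset.Nat.sum_antidiagonal_succ', Finset.Nat.sum_antidiagonal_succ]
      simp only [pow_zero, sub_self, mul_zero, zero_add]
      rw [← Finset.sum_add_distrib, ← ih]
      refine Finset.sum_congr rfl fun p _ => ?_
      have a1 := hP p.1
      have a2 := hP p.2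
      have a3 := hP (p.1 + a)
      have b1 := hP1 p.1
      have b2 := hP1 p.2
      have b3 := hP1 (p.1 + a)
      have c1 : x ^ ((p.1 + 1) * (p.1 + a + 1)) =
          x ^ (p.1 * (p.1 + a)) * x ^ p.1 * x ^ (p.1 + a + 1) := by
        rw [← pow_add, ← pow_add]; ring
      have c2 : x ^ (p.1 * (p.1 + a + 1)) = x ^ (p.1 * (p.1 + a)) * x ^ p.1 := by
        rw [← pow_add]; ring
      simp only [hf, ← add_assoc, qPoch_succ, show p.1 + 1 + a = p.1 + a + 1 by ring, c1, c2]
      generalize x ^ (p.1 + a + 1) = U at *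
      generalize x ^ (p.1 + 1) = S at *
      generalize x ^ (p.2 + 1) = T at *
      field_simp
      ring
    have hM := hP M
    have hM1 := hP1 M
    have hMa := hP (M + (a + 1))
    rw [show M + 1 + a = M + (a + 1) by ring, qPoch_succ, ← mul_left_inj' hM1, key]
    field_simp

/-- Bailey's lemma for the chain `baileyBeta`. -/
theorem baileyBeta_succ {x : ℝ} (h0 : 0 < x) (h1 : x < 1) (k r : ℕ) :
    baileyBeta x (k + 1) r =
      ∑ s ∈ Finset.range (r + 1), x ^ (s * s) * baileyBeta x k s * (qPoch x (r - s))⁻¹ := by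
  simp only [baileyBeta, Finset.mul_sum, Finset.sum_mul]
  rw [Finset.sum_comm' (s' := fun j => Finset.Ico j (r + 1)) (t' := Finset.range (r + 1)) (by
    intro s j
    simp only [Finset.mem_range, Finset.mem_Ico]
    omega)]
  refine Finset.sum_congr rfl fun j hj => ?_
  obtain ⟨M, rfl⟩ := Nat.exists_eq_add_of_le (Nat.lt_succ_iff.1 (Finset.mem_range.1 hj))
  have h := sum_qVandermonde h0 h1 M (j + j)
  rw [Finset.Nat.sum_antidiagonal_eq_sum_range_succ_mk] at h
  rw [Finset.sum_Ico_eq_sum_range, show j + M + 1 - j = M + 1 by omega,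
    show j + M - j = M by omega, show j + M + j = M + (j + j) by ring, div_eq_mul_inv, ← h,
    Finset.mul_sum]
  refine Finset.sum_congr rfl fun i _ => ?_
  rw [show j + M - (j + i) = M - i by omega, show j + i - j = i by omega,
    show j + i + j = i + (j + j) by ring,
    show (j + i) * (j + i) = j * j + i * (i + (j + j)) by ring, add_mul, one_mul, pow_add, pow_add]
  simp only [div_eq_mul_inv, mul_inv]
  ring

lemma summable_baileyAlpha {x : ℝ} (h0 : 0 < x) (h1 : x < 1) (k : ℕ) :
    Summable fun j => jacobiTerm 1 x j * x ^ (k * (j * j)) := by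
  refine .of_norm_bounded (summable_jacobiTerm one_pos h0 le_rfl h1.le (by simpa)).norm fun j => ?_
  rw [norm_mul]
  refine mul_le_of_le_one_right (norm_nonneg _) ?_
  rw [Real.norm_of_nonneg (by positivity)]
  exact pow_le_one₀ h0.le h1.le

theorem tendsto_baileyBeta {x : ℝ} (h0 : 0 < x) (h1 : x < 1) (k : ℕ) :
    Tendsto (baileyBeta x k) atTop (nhds ((∑' j, jacobiTerm 1 x j * x ^ (k * (j * j))) *
      ((∏' i : ℕ, (1 - x ^ (i + 1)))⁻¹ * (∏' i : ℕ, (1 - x ^ (i + 1)))⁻¹))) :=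
  tendsto_sum_div_qPoch_mul h0 h1 (summable_baileyAlpha h0 h1 k)

lemma summable_mul_baileyBeta {x : ℝ} (h0 : 0 < x) (h1 : x < 1) (k : ℕ) :
    Summable fun s => x ^ (s * s) * baileyBeta x k s := by
  obtain ⟨C, hC⟩ := (tendsto_baileyBeta h0 h1 k).abs.bddAbove_range
  refine .of_norm_bounded ((summable_geometric_of_lt_one h0.le h1).mul_right C) fun j => ?_
  rw [norm_mul, Real.norm_of_nonneg (by positivity)]
  exact mul_le_mul (pow_le_pow_of_le_one h0.le h1.le (Nat.le_mul_self j)) (hC ⟨j, rfl⟩)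
    (norm_nonneg _) (by positivity)

/-- The Andrews–Gordon identity (the case `i = k`) in product form. -/
theorem tprod_mul_tsum_baileyBeta {x : ℝ} (h0 : 0 < x) (h1 : x < 1) (k : ℕ) :
    (∏' i : ℕ, (1 - x ^ (i + 1))) * ∑' s, x ^ (s * s) * baileyBeta x k s =
      ∑' j, jacobiTerm (x ^ (k + 1)) (x ^ (k + 2)) j := by
  have hl := tendsto_sum_div_qPoch h0 h1 (summable_mul_baileyBeta h0 h1 k)
  simp only [← baileyBeta_succ h0 h1] at hl
  have := tendsto_nhds_unique hl (tendsto_baileyBeta h0 h1 (k + 1))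
  have hne := (tprod_qPoch_pos h0 h1).ne'
  have e : (fun j => jacobiTerm (x ^ (k + 1)) (x ^ (k + 2)) j) =
      fun j => jacobiTerm 1 x j * x ^ ((k + 1) * (j * j)) := by
    funext j
    unfold jacobiTerm
    split_ifs with h
    · simp [h]
    · rw [← choose_two_mul_two_add j]
      ring
  rw [e]
  field_simp at this ⊢
  linarith

lemma pow_mod_lt_one {x : ℝ} (h0 : 0 < x) (h1 : x < 1) (p : ℕ → Prop) [DecidablePred p] :
    Multipliable fun r : ℕ => if p (r + 1) then 1 - x ^ (r + 1) else 1 := by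
  have := multipliable_one_sub (f := fun r : ℕ => if p (r + 1) then x ^ (r + 1) else 0)
    ((summable_pow_succ h0 h1).of_nonneg_of_le (fun r => by positivity) fun r => by
      split_ifs; exacts [le_rfl, by positivity])
  refine this.congr fun r => ?_
  split_ifs <;> simp

/-- The Andrews–Gordon product, in terms of the Bailey chain. -/
theorem tprod_gordon {x : ℝ} (h0 : 0 < x) (h1 : x < 1) {k : ℕ} (hk : 1 ≤ k) :
    ∏' r : ℕ, (if (r + 1) % (2 * k + 1) = 0 ∨ (r + 1) % (2 * k + 1) = k ∨
      (r + 1) % (2 * k + 1) = k + 1 then 1 - x ^ (r + 1) else 1) =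
      ∑' j, jacobiTerm (x ^ k) (x ^ (k + 1)) j := by
  have hJ := tendsto_jacobi (pow_pos h0 k) (pow_pos h0 (k + 1)) (pow_le_one₀ h0.le h1.le)
    (pow_le_one₀ h0.le h1.le) (by rw [← pow_add]; exact pow_lt_one₀ h0.le h1 (by omega))
  have hT := (pow_mod_lt_one h0 h1 fun r => r % (2 * k + 1) = 0 ∨ r % (2 * k + 1) = k ∨
      r % (2 * k + 1) = k + 1).hasProd.tendsto_prod_nat
  have hT' := hT.comp (tendsto_id.const_mul_atTop' (show 0 < 2 * k + 1 by omega))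
  refine tendsto_nhds_unique hT' (hJ.congr fun m => ?_)
  simp only [Function.comp_apply, id]
  induction m with
  | zero => simp
  | succ m ih =>
    rw [Finset.prod_range_succ, ih, Nat.mul_succ, Finset.prod_range_add]
    congr 1
    obtain ⟨k, rfl⟩ := Nat.exists_eq_add_of_le' hk
    have e (s : ℕ) (hs : s < 2 * (k + 1)) :
        ((2 * (k + 1) + 1) * m + s + 1) % (2 * (k + 1) + 1) = s + 1 := by
      rw [add_assoc, Nat.mul_add_mod, Nat.mod_eq_of_lt (by omega)]
    have e0 : ((2 * (k + 1) + 1) * m + 2 * (k + 1) + 1) % (2 * (k + 1) + 1) = 0 := by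
      rw [add_assoc, ← Nat.mul_succ, Nat.mul_mod_right]
    rw [Finset.prod_range_succ, ← Finset.prod_subset (s₁ := {k, k + 1})]
    · rw [Finset.prod_pair (by omega), e k (by omega), e (k + 1) (by omega), e0,
        if_pos (by omega), if_pos (by omega), if_pos (by omega)]
      ring
    · intro s hs
      simp only [Finset.mem_insert, Finset.mem_singleton, Finset.mem_range] at hs ⊢
      omega
    · intro s hs hs'
      simp only [Finset.mem_insert, Finset.mem_singleton, Finset.mem_range] at hs hs'
      rw [e s hs, if_neg (by omega)]

section Counting

open Module

open Classical in
lemma natCard_and_eq_sum_fiber {X Y : Type*} [Finite X] [Fintype Y] (p : X → Prop) (f : X → Y)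
    (Q : Y → Prop) :
    Nat.card {x // p x ∧ Q (f x)} = ∑ y, if Q y then Nat.card {x // p x ∧ f x = y} else 0 := by
  have := Fintype.ofFinite X
  simp only [Nat.card_eq_fintype_card, Fintype.card_subtype]
  rw [Finset.card_eq_sum_card_fiberwise (f := f) (t := Finset.univ) (by simp)]
  refine Finset.sum_congr rfl fun y _ => ?_
  rw [Finset.filter_filter]
  split_ifs with h
  · congr 1
    ext x
    simp only [Finset.mem_filter, Finset.mem_univ, true_and]
    exact ⟨fun hx => ⟨hx.1.1, hx.2⟩, fun hx => ⟨⟨hx.1, hx.2.symm ▸ h⟩, hx.2⟩⟩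
  · rw [Finset.card_eq_zero, Finset.filter_eq_empty_iff]
    rintro x - ⟨⟨-, hx⟩, rfl⟩
    exact h hx

/-- The number of injective linear maps from a `j`-dimensional to an `m`-dimensional vector space
over a field with `q` elements. -/
noncomputable def injCount (q : ℝ) (j m : ℕ) : ℝ := ∏ i ∈ Finset.range j, (q ^ m - q ^ i)

lemma injCount_eq_zero (q : ℝ) {j m : ℕ} (h : m < j) : injCount q j m = 0 :=
  Finset.prod_eq_zero (Finset.mem_range.2 h) (sub_self _)

section LinearCount

variable {K : Type*} [Field K] [Fintype K] {U V W : Type*} [AddCommGroup U] [Module K U]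
  [AddCommGroup V] [Module K V] [AddCommGroup W] [Module K W]
  [FiniteDimensional K U] [FiniteDimensional K V] [FiniteDimensional K W]

lemma card_injective_linearMap :
    (Nat.card {f : U →ₗ[K] W // Function.Injective f} : ℝ) =
      injCount (Fintype.card K) (finrank K U) (finrank K W) := by
  have : Finite W := Module.finite_of_finite K
  let b := Module.finBasis K U
  have e : Nat.card {s : Fin (finrank K U) → W // LinearIndependent K s} =
      Nat.card {f : U →ₗ[K] W // Function.Injective f} := by
    refine Nat.card_congr ((b.constr K).toEquiv.subtypeEquiv fun s => ?_)
    rw [linearIndependent_iff_injective_fintypeLinearCombination]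
    have : b.constr K s = (Fintype.linearCombination K s).comp b.equivFun.toLinearMap := by
      refine b.ext fun i => ?_
      simp [Fintype.linearCombination_apply, Finsupp.single_apply]
    change _ ↔ Function.Injective (b.constr K s)
    rw [this]
    simp
  rw [← e]
  rcases le_or_gt (finrank K U) (finrank K W) with h | h
  · rw [card_linearIndependent h, injCount, Nat.cast_prod,
      ← Fin.prod_univ_eq_prod_range fun i =>
        (Fintype.card K : ℝ) ^ finrank K W - Fintype.card K ^ i]
    refine Finset.prod_congr rfl fun i _ => ?_
    rw [Nat.cast_sub (Nat.pow_le_pow_right Fintype.card_pos (i.2.le.trans h))]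
    push_cast
    rfl
  · rw [injCount_eq_zero _ h, Nat.cast_eq_zero, Nat.card_eq_zero]
    left
    refine ⟨fun s => h.not_ge ?_⟩
    simpa using s.2.fintype_card_le_finrank

lemma card_surjective_linearMap :
    (Nat.card {f : V →ₗ[K] W // Function.Surjective f} : ℝ) =
      injCount (Fintype.card K) (finrank K W) (finrank K V) := by
  rw [← Subspace.dual_finrank_eq (K := K) (V := V), ← Subspace.dual_finrank_eq (K := K) (V := W),
    ← card_injective_linearMap]
  have hi : Function.Injective (Module.Dual.transpose (R := K) (M := V) (M' := W)) := by
    intro f g h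
    ext v
    rw [← sub_eq_zero, ← Module.forall_dual_apply_eq_zero_iff K]
    intro φ
    have : φ (f v) = φ (g v) := LinearMap.congr_fun (LinearMap.congr_fun h φ) v
    rw [map_sub, this, sub_self]
  have hd : finrank K (V →ₗ[K] W) = finrank K (Dual K W →ₗ[K] Dual K V) := by
    rw [finrank_linearMap, finrank_linearMap, Subspace.dual_finrank_eq, Subspace.dual_finrank_eq,
      mul_comm]
  have : Finite (Dual K W →ₗ[K] Dual K V) := Module.finite_of_finite K
  have hb := hi.bijective_of_nat_card_le (by
    rw [Module.natCard_eq_pow_finrank (K := K), ← hd, ← Module.natCard_eq_pow_finrank])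
  congr 1
  exact Nat.card_congr ((Equiv.ofBijective _ hb).subtypeEquiv fun f =>
    (LinearMap.dualMap_injective_iff (f := f)).symm)

lemma card_injectiveOn_linearMap (S : Submodule K W) :
    (Nat.card {f : W →ₗ[K] U // Function.Injective (f.domRestrict S)} : ℝ) =
      injCount (Fintype.card K) (finrank K S) (finrank K U) *
        (Fintype.card K : ℝ) ^ ((finrank K W - finrank K S) * finrank K U) := by
  obtain ⟨T, hT⟩ := Submodule.exists_isCompl S
  have e : Nat.card {f : W →ₗ[K] U // Function.Injective (f.domRestrict S)} =
      Nat.card ({f : S →ₗ[K] U // Function.Injective f} × (T →ₗ[K] U)) := by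
    refine Nat.card_congr (Equiv.trans ?_ (Equiv.prodSubtypeFstEquivSubtypeProd
      (p := fun f : S →ₗ[K] U => Function.Injective f)))
    exact (LinearMap.ofIsComplProdEquiv hT).symm.toEquiv.subtypeEquiv fun f => Iff.rfl
  have : Finite U := Module.finite_of_finite K
  rw [e, Nat.card_prod, Nat.cast_mul, card_injective_linearMap,
    Module.natCard_eq_pow_finrank (K := K) (V := T →ₗ[K] U), Module.finrank_linearMap,
    ← Submodule.finrank_add_eq_of_isCompl hT, Nat.add_sub_cancel_left, Nat.card_eq_fintype_card]
  push_cast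
  rfl

lemma card_injective_comp_eq {π : V →ₗ[K] W} (hπ : Function.Surjective π) (N : End K W) :
    (Nat.card {i : W →ₗ[K] V // Function.Injective i ∧ π ∘ₗ i = N} : ℝ) =
      injCount (Fintype.card K) (finrank K (LinearMap.ker N)) (finrank K (LinearMap.ker π)) *
        (Fintype.card K : ℝ) ^
          ((finrank K W - finrank K (LinearMap.ker N)) * finrank K (LinearMap.ker π)) := by
  rw [← card_injectiveOn_linearMap]
  obtain ⟨s, hs⟩ := π.exists_rightInverse_of_surjective (LinearMap.range_eq_top.2 hπ)
  have hs' (w : W) : π (s w) = w := LinearMap.congr_fun hs w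
  have hker (D : W →ₗ[K] LinearMap.ker π) (w : W) : π (D w) = 0 := (D w).2
  congr 1
  refine Nat.card_congr (Equiv.symm ?_)
  refine
    { toFun := fun D => ⟨s ∘ₗ N + (LinearMap.ker π).subtype ∘ₗ D.1, ?_, ?_⟩
      invFun := fun i => ⟨LinearMap.codRestrict (LinearMap.ker π) (i.1 - s ∘ₗ N) ?_, ?_⟩
      left_inv := ?_
      right_inv := ?_ }
  · rw [injective_iff_map_eq_zero]
    intro w hw
    have h1 : N w = 0 := by simpa [hs', hker] using congrArg π hw
    have h2 : D.1.domRestrict (LinearMap.ker N) ⟨w, h1⟩ = 0 := by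
      simpa [h1] using hw
    exact congrArg Subtype.val ((injective_iff_map_eq_zero _).1 D.2 _ h2)
  · ext w
    simp [hs', hker]
  · intro w
    have := LinearMap.congr_fun i.2.2 w
    simp only [LinearMap.comp_apply] at this
    simp [hs', this]
  · rw [injective_iff_map_eq_zero]
    intro w hw
    have h1 : N w = 0 := w.2
    have h2 : i.1 w = 0 := by simpa [h1] using congrArg Subtype.val hw
    exact Subtype.ext ((injective_iff_map_eq_zero _).1 i.2.1 _ h2)
  · intro D
    ext w
    simp
  · intro i
    ext w
    simp

lemma card_factorization (N : End K V) (hN : finrank K (LinearMap.range N) = finrank K W) :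
    (Nat.card {p : (W →ₗ[K] V) × (V →ₗ[K] W) //
      (Function.Injective p.1 ∧ Function.Surjective p.2) ∧ p.1 ∘ₗ p.2 = N} : ℝ) =
      injCount (Fintype.card K) (finrank K W) (finrank K W) := by
  have e : Nat.card {p : (W →ₗ[K] V) × (V →ₗ[K] W) //
      (Function.Injective p.1 ∧ Function.Surjective p.2) ∧ p.1 ∘ₗ p.2 = N} =
      Nat.card {j : W →ₗ[K] LinearMap.range N // Function.Injective j} := by
    refine Nat.card_congr
      { toFun := fun p => ⟨p.1.1.codRestrict (LinearMap.range N) ?_, ?_⟩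
        invFun := fun j => ⟨((LinearMap.range N).subtype ∘ₗ j.1,
          (LinearEquiv.ofBijective j.1 ⟨j.2,
            (LinearMap.injective_iff_surjective_of_finrank_eq_finrank hN.symm).1
              j.2⟩).symm.toLinearMap ∘ₗ N.rangeRestrict), ⟨?_, ?_⟩, ?_⟩
        left_inv := ?_
        right_inv := ?_ }
    · intro w
      obtain ⟨v, rfl⟩ := p.2.1.2 w
      exact ⟨v, (LinearMap.congr_fun p.2.2 v).symm⟩
    · exact fun a b h => p.2.1.1 (congrArg Subtype.val h)
    · exact Subtype.val_injective.comp j.2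
    · rw [LinearMap.coe_comp, LinearEquiv.coe_coe]
      exact (LinearEquiv.surjective _).comp N.surjective_rangeRestrict
    · ext v
      have hj (y) : j.1 ((LinearEquiv.ofBijective j.1 ⟨j.2,
            (LinearMap.injective_iff_surjective_of_finrank_eq_finrank hN.symm).1
              j.2⟩).symm y) = y := LinearEquiv.apply_symm_apply (LinearEquiv.ofBijective j.1 _) y
      simp [hj]
    · rintro ⟨⟨i, π⟩, ⟨hi, hπ⟩, h⟩
      refine Subtype.ext (Prod.ext (by ext; simp) ?_)
      ext v
      refine (LinearEquiv.symm_apply_eq _).2 (Subtype.ext ?_)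
      exact (LinearMap.congr_fun h v).symm
    · intro j
      ext
      simp
  rw [e, card_injective_linearMap, hN]

lemma card_surjective_comp_eq (N : End K W) {r : ℕ} (hr : finrank K V = finrank K W + r) :
    (Nat.card {p : (W →ₗ[K] V) × (V →ₗ[K] W) //
      (Function.Injective p.1 ∧ Function.Surjective p.2) ∧ p.2 ∘ₗ p.1 = N} : ℝ) =
      injCount (Fintype.card K) (finrank K W) (finrank K V) *
        (injCount (Fintype.card K) (finrank K (LinearMap.ker N)) r *
          (Fintype.card K : ℝ) ^ ((finrank K W - finrank K (LinearMap.ker N)) * r)) := by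
  classical
  have : Finite (W →ₗ[K] V) := Module.finite_of_finite K
  have : Finite (V →ₗ[K] W) := Module.finite_of_finite K
  have := Fintype.ofFinite (V →ₗ[K] W)
  have e : Nat.card {p : (W →ₗ[K] V) × (V →ₗ[K] W) //
      (Function.Injective p.1 ∧ Function.Surjective p.2) ∧ p.2 ∘ₗ p.1 = N} =
      ∑ π : V →ₗ[K] W, if Function.Surjective π then
        Nat.card {i : W →ₗ[K] V // Function.Injective i ∧ π ∘ₗ i = N} else 0 := by
    rw [Nat.card_congr (Equiv.subtypeEquivRight (q := fun p : (W →ₗ[K] V) × (V →ₗ[K] W) =>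
      (Function.Injective p.1 ∧ p.2 ∘ₗ p.1 = N) ∧ Function.Surjective p.2) fun p => by tauto),
      natCard_and_eq_sum_fiber _ Prod.snd (fun π : V →ₗ[K] W => Function.Surjective π)]
    refine Finset.sum_congr rfl fun π _ => ?_
    split_ifs
    · refine Nat.card_congr
        { toFun := fun p => ⟨p.1.1, p.2.1.1, (congrArg (· ∘ₗ p.1.1) p.2.2).symm.trans p.2.1.2⟩
          invFun := fun i => ⟨(i.1, π), i.2, rfl⟩
          left_inv := ?_
          right_inv := fun i => rfl }
      rintro ⟨⟨i, _⟩, _, rfl⟩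
      rfl
    · rfl
  rw [e, ← card_surjective_linearMap, ← Finset.sum_filter, Nat.cast_sum, Finset.sum_congr rfl,
    Finset.sum_const, Nat.card_eq_fintype_card, Fintype.card_subtype, nsmul_eq_mul]
  intro π hπ
  have hπ : Function.Surjective π := (Finset.mem_filter.1 hπ).2
  rw [card_injective_comp_eq hπ]
  have : finrank K (LinearMap.ker π) = r := by
    have := π.finrank_range_add_finrank_ker
    rw [LinearMap.range_eq_top.2 hπ, finrank_top] at this
    omega
  rw [this]

lemma card_ker_eq_of_comp_iff {Q : End K V → Prop} {Q' : End K W → Prop} {r : ℕ}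
    (hr : finrank K V = finrank K W + r)
    (hQ : ∀ (i : W →ₗ[K] V) (π : V →ₗ[K] W), Function.Injective i → Function.Surjective π →
      (Q (i ∘ₗ π) ↔ Q' (π ∘ₗ i))) :
    injCount (Fintype.card K) (finrank K W) (finrank K W) *
        (Nat.card {N : End K V // Q N ∧ finrank K (LinearMap.ker N) = r} : ℝ) =
      injCount (Fintype.card K) (finrank K W) (finrank K V) *
        ∑ s ∈ Finset.range (r + 1),
          (Nat.card {N : End K W // Q' N ∧ finrank K (LinearMap.ker N) = s} : ℝ) *
            (injCount (Fintype.card K) s r * (Fintype.card K : ℝ) ^ ((finrank K W - s) * r)) := by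
  classical
  have : Finite (W →ₗ[K] V) := Module.finite_of_finite K
  have : Finite (V →ₗ[K] W) := Module.finite_of_finite K
  have : Finite (End K V) := Module.finite_of_finite K
  have : Finite (End K W) := Module.finite_of_finite K
  have := Fintype.ofFinite (End K V)
  have := Fintype.ofFinite (End K W)
  have e : Nat.card {p : (W →ₗ[K] V) × (V →ₗ[K] W) //
      (Function.Injective p.1 ∧ Function.Surjective p.2) ∧ Q (p.1 ∘ₗ p.2)} =
      Nat.card {p : (W →ₗ[K] V) × (V →ₗ[K] W) //
      (Function.Injective p.1 ∧ Function.Surjective p.2) ∧ Q' (p.2 ∘ₗ p.1)} :=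
    Nat.card_congr (Equiv.subtypeEquivRight fun p => and_congr_right fun h => hQ _ _ h.1 h.2)
  rw [natCard_and_eq_sum_fiber _ (fun p : (W →ₗ[K] V) × (V →ₗ[K] W) => p.1 ∘ₗ p.2),
    natCard_and_eq_sum_fiber _ (fun p : (W →ₗ[K] V) × (V →ₗ[K] W) => p.2 ∘ₗ p.1)] at e
  have e := congrArg (Nat.cast : ℕ → ℝ) e
  simp only [Nat.cast_sum, Nat.cast_ite, card_surjective_comp_eq _ hr, Nat.cast_zero] at e
  convert e using 1
  · rw [Nat.card_eq_fintype_card, Fintype.card_subtype, mul_comm, ← nsmul_eq_mul,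
      ← Finset.sum_const, Finset.sum_filter]
    refine Finset.sum_congr rfl fun N _ => ?_
    have hN := N.finrank_range_add_finrank_ker
    by_cases hQN : Q N
    · by_cases hd : finrank K (LinearMap.ker N) = r
      · rw [if_pos ⟨hQN, hd⟩, if_pos hQN, card_factorization N (by omega)]
      · rw [if_neg (fun h => hd h.2), if_pos hQN, eq_comm, Nat.cast_eq_zero, Nat.card_eq_zero]
        refine Or.inl ⟨?_⟩
        rintro ⟨⟨i, π⟩, ⟨hi, hπ⟩, rfl⟩
        have := π.finrank_range_add_finrank_ker
        rw [LinearMap.range_eq_top.2 hπ, finrank_top] at this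
        rw [LinearMap.ker_comp_of_ker_eq_bot _ (LinearMap.ker_eq_bot.2 hi)] at hd
        simp only at hd
        omega
    · rw [if_neg (fun h => hQN h.1), if_neg hQN]
  · rw [← Finset.sum_filter, ← Finset.mul_sum]
    congr 1
    have hs : ∀ s ∈ Finset.range (finrank K W + r + 1), s ∉ Finset.range (r + 1) →
        (Nat.card {N : End K W // Q' N ∧ finrank K (LinearMap.ker N) = s} : ℝ) *
          (injCount (Fintype.card K) s r *
            (Fintype.card K : ℝ) ^ ((finrank K W - s) * r)) = 0 := by
      intro s _ hs
      rw [injCount_eq_zero _ (by simpa using hs), zero_mul, mul_zero]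
    rw [Finset.sum_subset (Finset.range_mono (by omega)) hs,
      ← Finset.sum_fiberwise_of_maps_to (t := Finset.range (finrank K W + r + 1))
        (g := fun N : End K W => finrank K (LinearMap.ker N))]
    · refine Finset.sum_congr rfl fun s _ => ?_
      rw [Finset.sum_congr rfl (g := fun _ => injCount (Fintype.card K) s r *
            (Fintype.card K : ℝ) ^ ((finrank K W - s) * r))]
      · rw [Finset.sum_const, nsmul_eq_mul, Finset.filter_filter, Nat.card_eq_fintype_card,
          Fintype.card_subtype]
      · intro N hN
        rw [(Finset.mem_filter.1 hN).2]
    · intro N _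
      rw [Finset.mem_range]
      have := Submodule.finrank_le (LinearMap.ker N)
      omega

end LinearCount

lemma injCount_add {q : ℝ} (hq : 1 < q) (j a : ℕ) :
    injCount q j (a + j) = q ^ ((a + j) * j) * (qPoch q⁻¹ (a + j) / qPoch q⁻¹ a) := by
  have h0 : 0 < q⁻¹ := by positivity
  have h1 : q⁻¹ < 1 := inv_lt_one_of_one_lt₀ hq
  have hp := fun n => (qPoch_pos h0 h1 n).ne'
  induction j generalizing a with
  | zero => simp [injCount, div_self (hp a)]
  | succ j ih =>
    have e : a + (j + 1) = a + 1 + j := by ring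
    have h : injCount q (j + 1) (a + (j + 1)) =
        injCount q j (a + 1 + j) * (q ^ (a + 1 + j) - q ^ j) := by
      rw [injCount, Finset.prod_range_succ, e, ← injCount]
    have h2 : q ^ (a + 1 + j) - q ^ j = q ^ (a + 1 + j) * (1 - q⁻¹ ^ (a + 1)) := by
      have : q ≠ 0 := by positivity
      rw [pow_add, inv_pow]
      field_simp
    have h3 : 1 - q⁻¹ ^ (a + 1) ≠ 0 := by
      have := hp (a + 1)
      rw [qPoch_succ] at this
      exact right_ne_zero_of_mul this
    rw [h, ih, h2, e, qPoch_succ q⁻¹ a, Nat.mul_succ, pow_add q _ (a + 1 + j)]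
    have := hp a
    generalize q⁻¹ = x at *
    field_simp

lemma injCount_self {q : ℝ} (hq : 1 < q) (n : ℕ) :
    injCount q n n = q ^ (n * n) * qPoch q⁻¹ n := by
  simpa [qPoch_zero] using injCount_add hq n 0

lemma injCount_self_pos {q : ℝ} (hq : 1 < q) (n : ℕ) : 0 < injCount q n n := by
  rw [injCount_self hq]
  have := qPoch_pos (x := q⁻¹) (by positivity) (inv_lt_one_of_one_lt₀ hq) n
  positivity

lemma injCount_mul_div {q : ℝ} (hq : 1 < q) {s r d : ℕ} (hr : s ≤ r) (hd : s ≤ d) :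
    injCount q d (d + r) * (injCount q s r * q ^ ((d - s) * r)) =
      injCount q (d + r) (d + r) * (q⁻¹ ^ (r * r) * (qPoch q⁻¹ (r - s))⁻¹) := by
  obtain ⟨t, rfl⟩ := Nat.exists_eq_add_of_le' hr
  obtain ⟨u, rfl⟩ := Nat.exists_eq_add_of_le' hd
  rw [injCount_self hq, add_comm (u + s) (t + s), injCount_add hq, injCount_add hq,
    Nat.add_sub_cancel, Nat.add_sub_cancel, inv_pow]
  have h0 : 0 < q⁻¹ := by positivity
  have h1 : q⁻¹ < 1 := inv_lt_one_of_one_lt₀ hq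
  have ht := (qPoch_pos h0 h1 t).ne'
  have hts := (qPoch_pos h0 h1 (t + s)).ne'
  have hq0 : q ≠ 0 := by positivity
  have e : (q ^ ((t + s) * (t + s)))⁻¹ * q ^ ((t + s) * (t + s)) = 1 :=
    inv_mul_cancel₀ (by positivity)
  generalize (q ^ ((t + s) * (t + s)))⁻¹ = y at e ⊢
  generalize q⁻¹ = x at *
  field_simp
  linear_combination (-(q ^ (t * s * 2 + t * u * 2 + s * u * 4 + s ^ 2 * 3 + u ^ 2) *
    qPoch x (t + s + (u + s)))) * e

section BoundedUnipotent

variable {K : Type*} [Field K] {V W : Type*} [AddCommGroup V] [Module K V] [AddCommGroup W]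
  [Module K W]

/-- `1 + N` is invertible, and all Jordan blocks of `N` with eigenvalue `0` have size at most
`k`. -/
def BoundedUnipotentPart (k : ℕ) (N : End K V) : Prop :=
  IsUnit (1 + N) ∧ LinearMap.ker (N ^ k) = LinearMap.ker (N ^ (k + 1))

lemma comp_pow_succ (f : W →ₗ[K] V) (g : V →ₗ[K] W) (k : ℕ) :
    (f ∘ₗ g : End K V) ^ (k + 1) = f ∘ₗ ((g ∘ₗ f : End K W) ^ k) ∘ₗ g := by
  induction k with
  | zero => rfl
  | succ k ih => rw [pow_succ, ih, pow_succ]; rfl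

variable [FiniteDimensional K V] [FiniteDimensional K W]

lemma isUnit_one_add_comp {f : W →ₗ[K] V} {g : V →ₗ[K] W}
    (h : IsUnit (1 + g ∘ₗ f : End K W)) : IsUnit (1 + f ∘ₗ g : End K V) := by
  rw [LinearMap.isUnit_iff_ker_eq_bot, LinearMap.ker_eq_bot'] at h ⊢
  intro v hv
  have hv : v + f (g v) = 0 := hv
  have hg : g v = 0 := h _ (by simpa using congrArg g hv)
  simpa [hg] using hv

lemma boundedUnipotentPart_comp_iff (k : ℕ) {i : W →ₗ[K] V} {π : V →ₗ[K] W}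
    (hi : Function.Injective i) (hπ : Function.Surjective π) :
    BoundedUnipotentPart (k + 1) (i ∘ₗ π : End K V) ↔
      BoundedUnipotentPart k (π ∘ₗ i : End K W) := by
  have hker (f : End K W) : LinearMap.ker (i ∘ₗ f ∘ₗ π) = (LinearMap.ker f).comap π := by
    rw [LinearMap.ker_comp_of_ker_eq_bot _ (LinearMap.ker_eq_bot.2 hi), LinearMap.ker_comp]
  refine and_congr ⟨isUnit_one_add_comp, isUnit_one_add_comp⟩ ?_
  rw [comp_pow_succ, comp_pow_succ, hker, hker,
    (Submodule.comap_injective_of_surjective hπ).eq_iff]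

end BoundedUnipotent

/-- The proportion, relative to the order of `GL(n, K)`, of endomorphisms `N` of `K ^ n` such that
`1 + N` is invertible, all Jordan blocks of `N` with eigenvalue `0` have size at most `k`, and there
are exactly `r` of them. -/
noncomputable def boundedProportion (K : Type*) [Field K] [Fintype K] (k n r : ℕ) : ℝ :=
  Nat.card {N : End K (Fin n → K) //
    BoundedUnipotentPart k N ∧ finrank K (LinearMap.ker N) = r} / injCount (Fintype.card K) n n

section Proportion

variable (K : Type*) [Field K] [Fintype K]

lemma one_lt_card_real : (1 : ℝ) < Fintype.card K := by exact_mod_cast Fintype.one_lt_card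

lemma boundedProportion_nonneg (k n r : ℕ) : 0 ≤ boundedProportion K k n r :=
  div_nonneg (Nat.cast_nonneg _) (injCount_self_pos (one_lt_card_real K) n).le

lemma boundedProportion_of_lt (k : ℕ) {n r : ℕ} (h : n < r) : boundedProportion K k n r = 0 := by
  rw [boundedProportion, Nat.card_eq_zero.2 (Or.inl ⟨fun N => ?_⟩), Nat.cast_zero, zero_div]
  have := Submodule.finrank_le (LinearMap.ker N.1)
  rw [N.2.2, finrank_fin_fun] at this
  omega

lemma boundedProportion_succ (k d r : ℕ) :
    boundedProportion K (k + 1) (d + r) r = (Fintype.card K : ℝ)⁻¹ ^ (r * r) *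
      ∑ s ∈ Finset.range (r + 1),
        boundedProportion K k d s * (qPoch (Fintype.card K : ℝ)⁻¹ (r - s))⁻¹ := by
  have hq := one_lt_card_real K
  have h := card_ker_eq_of_comp_iff (K := K) (V := Fin (d + r) → K) (W := Fin d → K) (r := r)
    (by simp) (fun i π hi hπ => boundedUnipotentPart_comp_iff k hi hπ)
  rw [finrank_fin_fun, finrank_fin_fun] at h
  have hd := (injCount_self_pos hq d).ne'
  have hn := (injCount_self_pos hq (d + r)).ne'
  rw [boundedProportion, div_eq_iff hn]
  apply mul_left_cancel₀ hd
  rw [h, Finset.mul_sum, Finset.mul_sum, Finset.sum_mul, Finset.mul_sum]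
  refine Finset.sum_congr rfl fun s hs => ?_
  rcases lt_or_ge d s with hds | hds
  · have := boundedProportion_of_lt K k hds
    rw [this]
    rw [boundedProportion, div_eq_zero_iff, or_iff_left hd] at this
    rw [this]
    ring
  · have := injCount_mul_div hq (Nat.lt_succ_iff.1 (Finset.mem_range.1 hs)) hds
    rw [mul_left_comm, this, boundedProportion]
    field_simp

end Proportion

lemma sum_injCount_div {q : ℝ} (hq : 1 < q) {n r : ℕ} (hr : r ≤ n) :
    ∑ j ∈ Finset.range (n + 1),
      (-1) ^ j * q⁻¹ ^ ((j + 1).choose 2) / qPoch q⁻¹ j * injCount q j r =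
      if r = 0 then 1 else 0 := by
  have hq0 : q ≠ 0 := by positivity
  have hne (i : ℕ) : q ^ (i + 1) - 1 ≠ 0 := (sub_pos.2 (one_lt_pow₀ hq i.succ_ne_zero)).ne'
  have hc (j : ℕ) : q⁻¹ ^ ((j + 1).choose 2) / qPoch q⁻¹ j =
      (∏ i ∈ Finset.range j, (q ^ (i + 1) - 1))⁻¹ := by
    induction j with
    | zero => simp [qPoch_zero]
    | succ j ih =>
      rw [Finset.prod_range_succ, mul_inv, ← ih, Nat.choose_succ_succ' (j + 1),
        Nat.choose_one_right, pow_add, qPoch_succ, mul_comm (q⁻¹ ^ (j + 1)), mul_div_mul_comm]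
      congr 1
      have := hne j
      have h2 : 1 - q⁻¹ ^ (j + 1) = (q ^ (j + 1) - 1) * q⁻¹ ^ (j + 1) := by
        rw [inv_pow]
        field_simp
      rw [h2]
      field_simp
  have hsum (n : ℕ) : ∑ j ∈ Finset.range (n + 1),
      (-1) ^ j * q⁻¹ ^ ((j + 1).choose 2) / qPoch q⁻¹ j * injCount q j r =
      ∏ i ∈ Finset.range n, (q ^ (i + 1) - q ^ r) / (q ^ (i + 1) - 1) := by
    induction n with
    | zero => simp [injCount, qPoch_zero]
    | succ n ih =>
      have h : injCount q (n + 1) r =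
          (-1) ^ n * (∏ i ∈ Finset.range n, (q ^ (i + 1) - q ^ r)) * (q ^ r - 1) := by
        rw [injCount, Finset.prod_range_succ', pow_zero]
        congr 1
        rw [← Finset.card_range n, ← Finset.prod_const, Finset.card_range,
          ← Finset.prod_mul_distrib]
        exact Finset.prod_congr rfl fun i _ => by ring
      rw [Finset.sum_range_succ, ih, mul_div_assoc, hc, h, Finset.prod_div_distrib,
        Finset.prod_div_distrib, Finset.prod_range_succ, Finset.prod_range_succ]
      have := hne n
      have : ∏ i ∈ Finset.range n, (q ^ (i + 1) - 1) ≠ 0 :=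
        Finset.prod_ne_zero_iff.2 fun i _ => hne i
      have h1 : ((-1 : ℝ) ^ n) * (-1) ^ n = 1 := by rw [← mul_pow]; simp
      generalize ∏ i ∈ Finset.range n, (q ^ (i + 1) - q ^ r) = A at *
      generalize ∏ i ∈ Finset.range n, (q ^ (i + 1) - 1) = B at *
      rw [pow_succ]
      field_simp
      linear_combination (-A * (q ^ r - 1)) * h1
  rw [hsum]
  split_ifs with h
  · refine Finset.prod_eq_one fun i _ => ?_
    rw [h, pow_zero, div_self (hne i)]
  · refine Finset.prod_eq_zero (i := r - 1) (Finset.mem_range.2 (by omega)) ?_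
    rw [Nat.sub_add_cancel (by omega), sub_self, zero_div]

section Moments

variable {K : Type*} [Field K] {U V : Type*} [AddCommGroup U] [Module K U]
  [AddCommGroup V] [Module K V]

lemma exists_linearEquiv_comp_eq [FiniteDimensional K U] {f g : U →ₗ[K] V}
    (hf : Function.Injective f) (hg : Function.Injective g) :
    ∃ e : V ≃ₗ[K] V, e.toLinearMap ∘ₗ f = g := by
  obtain ⟨e, he⟩ := Submodule.exists_linearEquiv_restrict_eq
    ((LinearEquiv.ofInjective f hf).symm.trans (LinearEquiv.ofInjective g hg))
  refine ⟨e, LinearMap.ext fun u => ?_⟩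
  have := he (LinearEquiv.ofInjective f hf u)
  rw [LinearEquiv.trans_apply, LinearEquiv.symm_apply_apply] at this
  exact this.symm

variable [FiniteDimensional K V]

lemma card_comp_eq_zero [FiniteDimensional K U] {f g : U →ₗ[K] V} (hf : Function.Injective f)
    (hg : Function.Injective g) :
    Nat.card {N : End K V // IsUnit (1 + N) ∧ N ∘ₗ g = 0} =
      Nat.card {a : End K V // Function.Injective a ∧ a ∘ₗ f = g} := by
  obtain ⟨e, rfl⟩ := exists_linearEquiv_comp_eq hf hg
  refine Nat.card_congr (((Equiv.addLeft (1 : End K V)).trans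
    (LinearEquiv.congrLeft V K e.symm).toEquiv).subtypeEquiv fun N => ?_)
  change _ ↔ Function.Injective ((1 + N : End K V) ∘ e) ∧
    ((1 + N : End K V) ∘ₗ e.toLinearMap) ∘ₗ f = e.toLinearMap ∘ₗ f
  rw [LinearMap.isUnit_iff_ker_eq_bot, LinearMap.ker_eq_bot,
    Function.Injective.of_comp_iff' _ e.bijective, LinearMap.comp_assoc, LinearMap.add_comp,
    Module.End.one_eq_id, LinearMap.id_comp, add_eq_left]

open Classical in
lemma sum_injCount_finrank_ker [Fintype K] [Fintype (End K V)] {j : ℕ} (hj : j ≤ finrank K V) :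
    ∑ N : End K V with IsUnit (1 + N), injCount (Fintype.card K) j (finrank K (LinearMap.ker N)) =
      injCount (Fintype.card K) (finrank K V) (finrank K V) := by
  have : Finite ((Fin j → K) →ₗ[K] V) := Module.finite_of_finite K
  have := Fintype.ofFinite ((Fin j → K) →ₗ[K] V)
  obtain ⟨f, hf⟩ : ∃ f : (Fin j → K) →ₗ[K] V, Function.Injective f :=
    ⟨Fintype.linearCombination K _, linearIndependent_iff_injective_fintypeLinearCombination.1
      ((Module.finBasis K V).linearIndependent.comp _ (Fin.castLE_injective hj))⟩
  have hker (N : End K V) :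
      injCount (Fintype.card K) j (finrank K (LinearMap.ker N)) =
        Nat.card {g : (Fin j → K) →ₗ[K] V // Function.Injective g ∧ N ∘ₗ g = 0} := by
    have := card_injective_linearMap (K := K) (U := Fin j → K) (W := LinearMap.ker N)
    rw [finrank_fin_fun] at this
    rw [← this]
    congr 1
    exact Nat.card_congr
      { toFun := fun g => ⟨(LinearMap.ker N).subtype ∘ₗ g.1, Subtype.val_injective.comp g.2,
          LinearMap.ext fun u => (g.1 u).2⟩
        invFun := fun g => ⟨g.1.codRestrict (LinearMap.ker N) fun u => LinearMap.congr_fun g.2.2 u,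
          fun a b h => g.2.1 (congrArg Subtype.val h)⟩
        left_inv := fun g => rfl
        right_inv := fun g => rfl }
  have hcard : Nat.card {a : End K V // Function.Injective a} =
      ∑ g ∈ Finset.univ.filter fun g : (Fin j → K) →ₗ[K] V => Function.Injective g,
        Nat.card {N : End K V // IsUnit (1 + N) ∧ N ∘ₗ g = 0} := by
    rw [Nat.card_congr (Equiv.subtypeEquivRight (q := fun a : End K V =>
      Function.Injective a ∧ Function.Injective (a ∘ₗ f)) fun a =>
        ⟨fun h => ⟨h, h.comp hf⟩, And.left⟩),
      natCard_and_eq_sum_fiber _ (fun a : End K V => (a ∘ₗ f : (Fin j → K) →ₗ[K] V))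
        (fun g : (Fin j → K) →ₗ[K] V => Function.Injective g), Finset.sum_filter]
    refine Finset.sum_congr rfl fun g _ => ?_
    split_ifs with hg
    · exact (card_comp_eq_zero hf hg).symm
    · rfl
  rw [← card_injective_linearMap, hcard, Nat.cast_sum, Finset.sum_congr rfl fun N _ => hker N,
    ← Nat.cast_sum, ← Nat.cast_sum]
  congr 1
  simp only [Nat.card_eq_fintype_card, Fintype.card_subtype, ← Finset.filter_filter]
  exact Finset.sum_card_bipartiteAbove_eq_sum_card_bipartiteBelow _

end Moments

lemma boundedProportion_zero_of_ne (K : Type*) [Field K] [Fintype K] (n : ℕ) {r : ℕ} (hr : r ≠ 0) :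
    boundedProportion K 0 n r = 0 := by
  rw [boundedProportion, Nat.card_eq_zero.2 (Or.inl ⟨fun N => hr ?_⟩), Nat.cast_zero, zero_div]
  have := N.2.1.2
  rw [zero_add, pow_one, pow_zero, Module.End.one_eq_id, LinearMap.ker_id] at this
  rw [← N.2.2, ← this, finrank_bot]

lemma boundedProportion_zero_zero (K : Type*) [Field K] [Fintype K] (n : ℕ) :
    boundedProportion K 0 n 0 = ∑ j ∈ Finset.range (n + 1),
      (-1) ^ j * (Fintype.card K : ℝ)⁻¹ ^ ((j + 1).choose 2) / qPoch (Fintype.card K : ℝ)⁻¹ j := by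
  classical
  have hq := one_lt_card_real K
  have : Finite (End K (Fin n → K)) := Module.finite_of_finite K
  have := Fintype.ofFinite (End K (Fin n → K))
  rw [boundedProportion, div_eq_iff (injCount_self_pos hq n).ne']
  have h (j : ℕ) (hj : j ∈ Finset.range (n + 1)) :=
    sum_injCount_finrank_ker (K := K) (V := Fin n → K) (j := j) (by simp at hj ⊢; omega)
  simp only [finrank_fin_fun] at h
  rw [Finset.sum_mul, Finset.sum_congr rfl fun j hj => by rw [← h j hj, Finset.mul_sum],
    Finset.sum_comm, Finset.sum_congr rfl fun N _ => sum_injCount_div hq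
      ((Submodule.finrank_le (LinearMap.ker N)).trans_eq (finrank_fin_fun K)),
    ← Finset.sum_filter, Finset.filter_filter, Finset.sum_const, nsmul_one,
    Nat.card_eq_fintype_card, Fintype.card_subtype]
  congr 2
  ext N
  simp only [Finset.mem_filter, Finset.mem_univ, true_and]
  refine and_congr_left fun hN => and_iff_left ?_
  rw [Submodule.finrank_eq_zero] at hN
  rw [zero_add, pow_one, pow_zero, Module.End.one_eq_id, LinearMap.ker_id, hN]

lemma natCard_isUnit_one_add {K V : Type*} [Field K] [Fintype K] [AddCommGroup V] [Module K V]
    [FiniteDimensional K V] :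
    (Nat.card {N : End K V // IsUnit (1 + N)} : ℝ) =
      injCount (Fintype.card K) (finrank K V) (finrank K V) := by
  classical
  have : Finite (End K V) := Module.finite_of_finite K
  have := Fintype.ofFinite (End K V)
  rw [← sum_injCount_finrank_ker (Nat.zero_le (finrank K V)), Nat.card_eq_fintype_card,
    Fintype.card_subtype]
  simp [injCount]

section Limits

variable (K : Type*) [Field K] [Fintype K]

lemma sum_range_boundedProportion (k n m : ℕ) :
    ∑ s ∈ Finset.range m, boundedProportion K k n s =
      Nat.card {N : End K (Fin n → K) //
        BoundedUnipotentPart k N ∧ finrank K (LinearMap.ker N) < m} /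
          injCount (Fintype.card K) n n := by
  classical
  have : Finite (End K (Fin n → K)) := Module.finite_of_finite K
  have := Fintype.ofFinite (End K (Fin n → K))
  simp only [boundedProportion, Nat.card_eq_fintype_card, Fintype.card_subtype]
  rw [← Finset.sum_div, ← Nat.cast_sum, Finset.card_eq_sum_card_fiberwise
    (f := fun N : End K (Fin n → K) => finrank K (LinearMap.ker N)) (t := Finset.range m)
    (fun N hN => by simpa using (Finset.mem_filter.1 hN).2.2)]
  congr 2
  refine Finset.sum_congr rfl fun s hs => congrArg Finset.card ?_
  ext N
  simp only [Finset.mem_filter, Finset.mem_univ, true_and]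
  have := Finset.mem_range.1 hs
  exact ⟨fun h => ⟨⟨h.1, h.2 ▸ this⟩, h.2⟩, fun h => ⟨h.1.1, h.2⟩⟩

lemma sum_range_boundedProportion_le_one (k n m : ℕ) :
    ∑ s ∈ Finset.range m, boundedProportion K k n s ≤ 1 := by
  have : Finite (End K (Fin n → K)) := Module.finite_of_finite K
  have hpos := injCount_self_pos (one_lt_card_real K) n
  have h := natCard_isUnit_one_add (K := K) (V := Fin n → K)
  rw [finrank_fin_fun] at h
  rw [sum_range_boundedProportion, div_le_one hpos, ← h, Nat.cast_le]
  exact Nat.card_le_card_of_injective (fun N => ⟨N.1, N.2.1.1⟩)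
    fun M N h => Subtype.ext (Subtype.mk.inj h)

lemma tsum_boundedProportion (k n : ℕ) :
    ∑' r, boundedProportion K k n r =
      Nat.card {N : End K (Fin n → K) // BoundedUnipotentPart k N} /
        injCount (Fintype.card K) n n := by
  rw [tsum_eq_sum (s := Finset.range (n + 1)) fun r hr =>
    boundedProportion_of_lt K k (by simpa [Nat.lt_succ_iff] using hr), sum_range_boundedProportion]
  congr 2
  refine Nat.card_congr (Equiv.subtypeEquivRight fun N => and_iff_left ?_)
  exact Nat.lt_succ_of_le ((Submodule.finrank_le _).trans_eq (finrank_fin_fun K))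

lemma inv_card_pos : 0 < (Fintype.card K : ℝ)⁻¹ :=
  inv_pos.2 (zero_lt_one.trans (one_lt_card_real K))

lemma inv_card_lt_one : (Fintype.card K : ℝ)⁻¹ < 1 := inv_lt_one_of_one_lt₀ (one_lt_card_real K)

lemma tendsto_boundedProportion (k r : ℕ) :
    Tendsto (fun n => boundedProportion K k n r) atTop
      (nhds ((∏' i : ℕ, (1 - (Fintype.card K : ℝ)⁻¹ ^ (i + 1))) *
        ((Fintype.card K : ℝ)⁻¹ ^ (r * r) * baileyBeta (Fintype.card K : ℝ)⁻¹ k r))) := by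
  have h0 := inv_card_pos K
  have h1 := inv_card_lt_one K
  induction k generalizing r with
  | zero =>
    rw [baileyBeta_zero h0 h1]
    split_ifs with hr
    · subst hr
      simp only [boundedProportion_zero_zero, mul_zero, pow_zero, mul_one]
      exact (hasSum_euler h0 h1).tendsto_sum_nat.comp (tendsto_add_atTop_nat 1)
    · simp [boundedProportion_zero_of_ne K _ hr]
  | succ k ih =>
    rw [← tendsto_add_atTop_iff_nat r]
    simp only [boundedProportion_succ]
    rw [baileyBeta_succ h0 h1, mul_left_comm, Finset.mul_sum]
    refine (tendsto_finsetSum _ fun s _ => ?_).const_mul _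
    rw [← mul_assoc]
    exact (ih s).mul_const _

lemma boundedProportion_succ_le (k n r : ℕ) :
    boundedProportion K (k + 1) n r ≤
      (∏' i : ℕ, (1 - (Fintype.card K : ℝ)⁻¹ ^ (i + 1)))⁻¹ * (Fintype.card K : ℝ)⁻¹ ^ r := by
  have h0 := inv_card_pos K
  have h1 := inv_card_lt_one K
  have hP := (inv_pos.2 (tprod_qPoch_pos h0 h1)).le
  rcases lt_or_ge n r with h | h
  · rw [boundedProportion_of_lt K _ h]
    positivity
  obtain ⟨d, rfl⟩ := Nat.exists_eq_add_of_le' h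
  rw [boundedProportion_succ, mul_comm]
  refine mul_le_mul ?_ (pow_le_pow_of_le_one h0.le h1.le (Nat.le_mul_self r)) (by positivity) hP
  calc _ ≤ ∑ s ∈ Finset.range (r + 1), boundedProportion K k d s *
        (∏' i : ℕ, (1 - (Fintype.card K : ℝ)⁻¹ ^ (i + 1)))⁻¹ :=
      Finset.sum_le_sum fun s _ =>
        mul_le_mul_of_nonneg_left (inv_qPoch_le h0 h1 _) (boundedProportion_nonneg K k d s)
    _ ≤ _ := by
      rw [← Finset.sum_mul]
      exact mul_le_of_le_one_left hP (sum_range_boundedProportion_le_one K k d _)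

lemma tendsto_card_boundedUnipotentPart (k : ℕ) :
    Tendsto (fun n => (Nat.card {N : End K (Fin n → K) // BoundedUnipotentPart (k + 1) N} : ℝ) /
        injCount (Fintype.card K) n n) atTop
      (nhds (∑' j, jacobiTerm ((Fintype.card K : ℝ)⁻¹ ^ (k + 2))
        ((Fintype.card K : ℝ)⁻¹ ^ (k + 3)) j)) := by
  have h0 := inv_card_pos K
  have h1 := inv_card_lt_one K
  simp only [← tsum_boundedProportion]
  rw [← tprod_mul_tsum_baileyBeta h0 h1 (k + 1), ← tsum_mul_left]
  refine tendsto_tsum_of_dominated_convergence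
    ((summable_geometric_of_lt_one h0.le h1).mul_left
      (∏' i : ℕ, (1 - (Fintype.card K : ℝ)⁻¹ ^ (i + 1)))⁻¹)
    (fun r => tendsto_boundedProportion K (k + 1) r) (Eventually.of_forall fun n r => ?_)
  rw [Real.norm_of_nonneg (boundedProportion_nonneg K _ n r)]
  exact boundedProportion_succ_le K k n r

end Limits

lemma natCard_generalLinearGroup_subtype {K : Type*} [Field K] {n : ℕ}
    (Q : End K (Fin n → K) → Prop) :
    Nat.card {a : Matrix.GeneralLinearGroup (Fin n) K //
        Q (Matrix.toLin' ((a : Matrix (Fin n) (Fin n) K) - 1))} =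
      Nat.card {N : End K (Fin n → K) // IsUnit (1 + N) ∧ Q N} := by
  have h (M : Matrix (Fin n) (Fin n) K) :
      IsUnit (1 + Matrix.toLin' (M - 1) : End K (Fin n → K)) ↔ IsUnit M := by
    rw [← MulEquiv.isUnit_map (Matrix.toLinAlgEquiv' (R := K) (n := Fin n)) (x := M), map_sub,
      Matrix.toLin'_one, ← Module.End.one_eq_id, add_sub_cancel]
    rfl
  refine Nat.card_congr (Equiv.ofBijective
    (fun a => ⟨Matrix.toLin' ((a.1 : Matrix (Fin n) (Fin n) K) - 1), (h _).2 a.1.isUnit, a.2⟩)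
    ⟨fun a b hab => ?_, fun N => ?_⟩)
  · exact Subtype.ext (Units.ext (sub_left_injective
      (Matrix.toLin'.injective (congrArg Subtype.val hab))))
  · obtain ⟨M, hM⟩ := Matrix.toLin'.surjective N.1
    have hN : Matrix.toLin' (M + 1 - 1) = N.1 := by rw [add_sub_cancel_right, hM]
    obtain ⟨a, ha⟩ : IsUnit (M + 1) := (h _).1 (by rw [hN]; exact N.2.1)
    refine ⟨⟨a, ?_⟩, Subtype.ext ?_⟩
    · rw [ha, hN]
      exact N.2.2
    · simp only [ha, hN]

end Counting

/-- For a prime power `q` and `k ≥ 2`, the limit as `n → ∞` of the probability that a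
uniformly random `α ∈ GL(n,q)` has all parts of the partition `λ_{z-1}(α)` (the Jordan
block sizes for the eigenvalue 1) strictly less than `k` — i.e. that
`ker (α-1)^(k-1) = ker (α-1)^k` — equals
`∏_{r ≥ 1, r ≡ 0, ±k mod 2k+1} (1 - q^{-r})`. -/
theorem limit_prob_jordan_parts_lt (Fq : Type) [Field Fq] [Fintype Fq] [DecidableEq Fq]
    (q : ℕ) (hq : q = Fintype.card Fq) (k : ℕ) (hk : 2 ≤ k) :
    Tendsto (fun n : ℕ =>
        (Nat.card {α : Matrix.GeneralLinearGroup (Fin n) Fq //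
            LinearMap.ker (Matrix.toLin'
                (((α : Matrix (Fin n) (Fin n) Fq) - 1) ^ (k - 1))) =
              LinearMap.ker (Matrix.toLin'
                (((α : Matrix (Fin n) (Fin n) Fq) - 1) ^ k))} : ℝ) /
          Nat.card (Matrix.GeneralLinearGroup (Fin n) Fq))
      atTop
      (nhds (∏' r : ℕ,
        (if (r + 1) % (2 * k + 1) = 0 ∨ (r + 1) % (2 * k + 1) = k ∨
            (r + 1) % (2 * k + 1) = k + 1 then
          (1 - (q : ℝ) ^ (-((r : ℤ) + 1))) else 1))) := by
  obtain ⟨m, rfl⟩ := Nat.exists_eq_add_of_le' hk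
  subst hq
  have hpow (r : ℕ) : (Fintype.card Fq : ℝ) ^ (-((r : ℤ) + 1)) =
      (Fintype.card Fq : ℝ)⁻¹ ^ (r + 1) := by
    rw [_root_.zpow_neg, inv_pow]
    norm_cast
  simp only [hpow]
  rw [tprod_gordon (inv_card_pos Fq) (inv_card_lt_one Fq) (by omega)]
  refine (tendsto_card_boundedUnipotentPart Fq m).congr fun n => ?_
  congr 1
  · rw [Nat.cast_inj, eq_comm]
    simp only [Matrix.toLin'_pow]
    exact natCard_generalLinearGroup_subtype
      (fun N => LinearMap.ker (N ^ (m + 1)) = LinearMap.ker (N ^ (m + 2)))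
  · have h := natCard_generalLinearGroup_subtype (K := Fq) (n := n) fun _ => True
    simp only [and_true] at h
    rw [Nat.card_congr (Equiv.subtypeUnivEquiv fun _ => trivial)] at h
    rw [h, natCard_isUnit_one_add, Module.finrank_fin_fun]
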